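/- arXiv:2605.25914 — 2 statements merged into one kernel-verified Lean document; each statement's English description precedes it below -/
import Mathlib

section
/- Let α ∈ [0,1) and let m ≥ 4 be an integer with (m−2)(m−3)/(m−1)² > α, and let μ := μ(α). Define the sequence (t_s)_{s≥0} by t₀ := 0 and t_{s+1} := ψ_α(t_s). Then t_s → μ as s → ∞; in other words, the constant-α recursive value Λ(α,α,α,…) equals μ. -/
open Filter

/-- `g_m(z) = 6·Σ_{a<b<c} z_a z_b z_c`, the Lagrangian polynomial of the complete
`3`-graph on `m` vertices. -/
noncomputable def gPoly (m : ℕ) (z : Fin m → ℝ) : ℝ :=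
  6 * ∑ e ∈ Finset.powersetCard 3 (Finset.univ : Finset (Fin m)), ∏ i ∈ e, z i

/-- `ψ_b(t) = max_{z∈Δ_{m−1}} ( g_m(z) + t·z₁³ + b·z₂³ )`. -/
noncomputable def psi (m : ℕ) (hm : 3 ≤ m) (b t : ℝ) : ℝ :=
  sSup { v : ℝ | ∃ z ∈ stdSimplex ℝ (Fin m),
    v = gPoly m z + t * z ⟨0, by omega⟩ ^ 3 + b * z ⟨1, by omega⟩ ^ 3 }

/-- `μ(a) = max { (g_m(z) + a·z₂³)/(1 − z₁³) : z ∈ Δ_{m−1}, z₁ < 1 }`. -/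
noncomputable def muFun (m : ℕ) (hm : 3 ≤ m) (a : ℝ) : ℝ :=
  sSup { v : ℝ | ∃ z ∈ stdSimplex ℝ (Fin m), z ⟨0, by omega⟩ < 1 ∧
    v = (gPoly m z + a * z ⟨1, by omega⟩ ^ 3) / (1 - z ⟨0, by omega⟩ ^ 3) }

/-- The set `X` of maximizers in the definition of `μ(a)`. -/
def Xset (m : ℕ) (hm : 3 ≤ m) (a : ℝ) : Set (Fin m → ℝ) :=
  { z | z ∈ stdSimplex ℝ (Fin m) ∧ z ⟨0, by omega⟩ < 1 ∧
    (gPoly m z + a * z ⟨1, by omega⟩ ^ 3) / (1 - z ⟨0, by omega⟩ ^ 3) = muFun m hm a }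

lemma gPoly_nonneg {m : ℕ} {z : Fin m → ℝ} (hz : z ∈ stdSimplex ℝ (Fin m)) : 0 ≤ gPoly m z :=
  mul_nonneg (by norm_num) (Finset.sum_nonneg fun _ _ => Finset.prod_nonneg fun i _ => hz.1 i)

lemma le_one_of_mem_stdSimplex {m : ℕ} {z : Fin m → ℝ} (hz : z ∈ stdSimplex ℝ (Fin m))
    (i : Fin m) : z i ≤ 1 :=
  hz.2 ▸ Finset.single_le_sum (fun j _ => hz.1 j) (Finset.mem_univ i)

lemma le_one_sub_of_ne {m : ℕ} {z : Fin m → ℝ} (hz : z ∈ stdSimplex ℝ (Fin m)) {i j : Fin m}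
    (hij : j ≠ i) : z j ≤ 1 - z i := by
  have h := Finset.sum_le_univ_sum_of_nonneg (s := {j, i}) hz.1
  rw [Finset.sum_pair hij, hz.2] at h
  linarith

/-- Off the vertex `i` of the simplex, `g_m` is at most a constant times the distance to it. -/
lemma gPoly_le_mul_one_sub {m : ℕ} {z : Fin m → ℝ} (hz : z ∈ stdSimplex ℝ (Fin m)) (i : Fin m) :
    gPoly m z ≤ 6 * (m.choose 3) * (1 - z i) := by
  have h : ∀ e ∈ Finset.powersetCard 3 (Finset.univ : Finset (Fin m)),
      ∏ j ∈ e, z j ≤ 1 - z i := by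
    intro e he
    obtain ⟨j, hje, hji⟩ := Finset.exists_mem_ne
      (by rw [(Finset.mem_powersetCard.1 he).2]; norm_num : 1 < e.card) i
    rw [← Finset.mul_prod_erase e z hje]
    calc z j * ∏ k ∈ e.erase j, z k ≤ z j * 1 :=
          mul_le_mul_of_nonneg_left
            (Finset.prod_le_one (fun k _ => hz.1 k) fun k _ => le_one_of_mem_stdSimplex hz k)
            (hz.1 j)
      _ ≤ 1 - z i := by rw [mul_one]; exact le_one_sub_of_ne hz hji
  have hs := Finset.sum_le_card_nsmul _ _ _ h
  rw [Finset.card_powersetCard, Finset.card_univ, Fintype.card_fin, nsmul_eq_mul] at hs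
  unfold gPoly
  linarith

lemma gPoly_add_le_mul_one_sub {m : ℕ} {z : Fin m → ℝ} (hz : z ∈ stdSimplex ℝ (Fin m))
    {i j : Fin m} (hij : j ≠ i) {a : ℝ} (ha : a ≤ 1) :
    gPoly m z + a * z j ^ 3 ≤ (6 * (m.choose 3) + 1) * (1 - z i) := by
  have h0 := hz.1 j
  have h1 : a * z j ^ 3 ≤ 1 * z j ^ 3 := mul_le_mul_of_nonneg_right ha (pow_nonneg h0 3)
  have h2 : z j ^ 3 ≤ z j := pow_le_of_le_one h0 (le_one_of_mem_stdSimplex hz j) (by norm_num)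
  linarith [gPoly_le_mul_one_sub hz i, le_one_sub_of_ne hz hij]

lemma one_sub_cube_pos {x : ℝ} (h0 : 0 ≤ x) (h1 : x < 1) : 0 < 1 - x ^ 3 :=
  sub_pos.2 (pow_lt_one₀ h0 h1 (by norm_num))

lemma muFun_nonneg {m : ℕ} (hm : 3 ≤ m) {a : ℝ} (ha : 0 ≤ a) : 0 ≤ muFun m hm a := by
  refine Real.sSup_nonneg ?_
  rintro v ⟨z, hz, hz1, rfl⟩
  exact div_nonneg (add_nonneg (gPoly_nonneg hz) (mul_nonneg ha (pow_nonneg (hz.1 _) 3)))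
    (one_sub_cube_pos (hz.1 _) hz1).le

lemma le_muFun {m : ℕ} (hm : 3 ≤ m) {a : ℝ} (ha : a ≤ 1) {z : Fin m → ℝ}
    (hz : z ∈ stdSimplex ℝ (Fin m)) (hz1 : z ⟨0, by omega⟩ < 1) :
    (gPoly m z + a * z ⟨1, by omega⟩ ^ 3) / (1 - z ⟨0, by omega⟩ ^ 3) ≤ muFun m hm a := by
  refine le_csSup ⟨6 * (m.choose 3) + 1, ?_⟩ ⟨z, hz, hz1, rfl⟩
  rintro v ⟨w, hw, hw1, rfl⟩
  rw [div_le_iff₀ (one_sub_cube_pos (hw.1 _) hw1)]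
  refine (gPoly_add_le_mul_one_sub hw (i := ⟨0, by omega⟩) (by simp) ha).trans
    (mul_le_mul_of_nonneg_left ?_ (by positivity))
  linarith [pow_le_of_le_one (hw.1 ⟨0, by omega⟩) hw1.le (by norm_num : (3 : ℕ) ≠ 0)]

/-- `μ(a)` dominates the objective function of `ψ_a(t)` whenever `t ≤ μ(a)`. -/
lemma psi_objective_le_muFun {m : ℕ} (hm : 3 ≤ m) {a t : ℝ} (ha : a ≤ 1) (ht : t ≤ muFun m hm a)
    {z : Fin m → ℝ} (hz : z ∈ stdSimplex ℝ (Fin m)) :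
    gPoly m z + t * z ⟨0, by omega⟩ ^ 3 + a * z ⟨1, by omega⟩ ^ 3 ≤ muFun m hm a := by
  rcases (le_one_of_mem_stdSimplex hz ⟨0, by omega⟩).lt_or_eq with h | h
  · have h1 := (div_le_iff₀ (one_sub_cube_pos (hz.1 _) h)).1 (le_muFun hm ha hz h)
    have h2 := mul_le_mul_of_nonneg_right ht (pow_nonneg (hz.1 ⟨0, by omega⟩) 3)
    linarith
  · have h1 := gPoly_add_le_mul_one_sub hz
      (i := ⟨0, by omega⟩) (j := ⟨1, by omega⟩) (by simp) ha
    rw [h, sub_self, mul_zero] at h1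
    rw [h]
    linarith

lemma le_psi {m : ℕ} (hm : 3 ≤ m) {a t : ℝ} (ha : a ≤ 1) (ht : t ≤ muFun m hm a)
    {z : Fin m → ℝ} (hz : z ∈ stdSimplex ℝ (Fin m)) :
    gPoly m z + t * z ⟨0, by omega⟩ ^ 3 + a * z ⟨1, by omega⟩ ^ 3 ≤ psi m hm a t := by
  refine le_csSup ⟨muFun m hm a, ?_⟩ ⟨z, hz, rfl⟩
  rintro v ⟨w, hw, rfl⟩
  exact psi_objective_le_muFun hm ha ht hw

lemma psi_le_muFun {m : ℕ} (hm : 3 ≤ m) {a t : ℝ} (ha : a ≤ 1) (ht : t ≤ muFun m hm a) :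
    psi m hm a t ≤ muFun m hm a := by
  refine csSup_le ⟨_, _, single_mem_stdSimplex ℝ ⟨0, by omega⟩, rfl⟩ ?_
  rintro v ⟨z, hz, rfl⟩
  exact psi_objective_le_muFun hm ha ht hz

lemma self_le_psi {m : ℕ} (hm : 3 ≤ m) {a t : ℝ} (ha : a ≤ 1) (ht : t ≤ muFun m hm a) :
    t ≤ psi m hm a t := by
  have hz := single_mem_stdSimplex ℝ (⟨0, by omega⟩ : Fin m)
  have h := le_psi hm ha ht hz
  have hg := gPoly_nonneg hz
  simp at h
  linarith

/-- The constant-`α` recursion converges to `μ`: if `t₀ = 0` and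
`t_{s+1} = ψ_α(t_s)`, then `t_s → μ(α)`; in other words `Λ(α,α,α,…) = μ`. -/
theorem constant_alpha_recursion (m : ℕ) (hm : 3 ≤ m) (hm4 : 4 ≤ m) (α : ℝ)
    (hα : α ∈ Set.Ico (0 : ℝ) 1)
    (hgap : α < ((m : ℝ) - 2) * ((m : ℝ) - 3) / ((m : ℝ) - 1) ^ 2)
    (t : ℕ → ℝ) (ht0 : t 0 = 0) (hts : ∀ s, t (s + 1) = psi m hm α (t s)) :
    Filter.Tendsto t Filter.atTop (nhds (muFun m hm α)) := by
  have hα1 : α ≤ 1 := hα.2.le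
  have hle : ∀ s, t s ≤ muFun m hm α := fun s => by
    induction s with
    | zero => exact ht0 ▸ muFun_nonneg hm hα.1
    | succ s ih => exact hts s ▸ psi_le_muFun hm hα1 ih
  have hmono : Monotone t := monotone_nat_of_le_succ fun s =>
    hts s ▸ self_le_psi hm hα1 (hle s)
  have hbdd : BddAbove (Set.range t) := ⟨_, Set.forall_mem_range.2 hle⟩
  have hlim := tendsto_atTop_ciSup hmono hbdd
  suffices h : muFun m hm α = ⨆ s, t s by rwa [h]
  refine le_antisymm (Real.sSup_le ?_ (ht0 ▸ le_ciSup hbdd 0)) (ciSup_le hle)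
  rintro v ⟨z, hz, hz1, rfl⟩
  rw [div_le_iff₀ (one_sub_cube_pos (hz.1 _) hz1)]
  have h := le_of_tendsto_of_tendsto'
    (((hlim.mul_const (z ⟨0, by omega⟩ ^ 3)).const_add (gPoly m z)).add_const
      (α * z ⟨1, by omega⟩ ^ 3))
    (hlim.comp (tendsto_add_atTop_nat 1))
    fun s => (le_psi hm hα1 (hle s) hz).trans_eq (hts s).symm
  linarith
end

section
/- Let r ≥ 3 be an integer, let x ∈ Π^{(r)}_∞, and let M ≥ 2 be an integer. Then 1 − (1 − x)/M^{r−1} ∈ Π^{(r)}_∞. -/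
open Filter

/-- A finite `r`-graph: a collection of `r`-element subsets (edges) of a finite
vertex set, which we take to be `Fin n`. -/
structure HGraph (r : ℕ) where
  n : ℕ
  edges : Finset (Finset (Fin n))
  card_eq : ∀ e ∈ edges, e.card = r

/-- `H` embeds into `G` as a subgraph (via an injective map on vertices sending
edges to edges). -/
def HGraph.Embeds {r : ℕ} (H G : HGraph r) : Prop :=
  ∃ f : Fin H.n → Fin G.n, Function.Injective f ∧ ∀ e ∈ H.edges, e.image f ∈ G.edges

/-- `G` is `F`-free: no member of the family `F` embeds into `G`. -/
def IsFree {r : ℕ} (F : Set (HGraph r)) (G : HGraph r) : Prop :=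
  ∀ H ∈ F, ¬ H.Embeds G

/-- `ex(n, F)`: the maximum number of edges of an `F`-free `r`-graph on `n` vertices. -/
noncomputable def exNum (r : ℕ) (F : Set (HGraph r)) (n : ℕ) : ℕ :=
  sSup { m : ℕ | ∃ G : HGraph r, G.n = n ∧ IsFree F G ∧ G.edges.card = m }

/-- The Turán density of the family `F` is `x`. -/
def HasTuranDensity (r : ℕ) (F : Set (HGraph r)) (x : ℝ) : Prop :=
  Tendsto (fun n => (exNum r F n : ℝ) / (n.choose r : ℝ)) atTop (nhds x)

/-- `Π^{(r)}_∞`: the set of Turán densities of (possibly infinite) families of `r`-graphs. -/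
def PiInf (r : ℕ) : Set ℝ := { x | ∃ F : Set (HGraph r), HasTuranDensity r F x }

namespace HGraph

variable {r : ℕ}

theorem Embeds.refl (G : HGraph r) : G.Embeds G :=
  ⟨id, Function.injective_id, fun e he => by simpa using he⟩

theorem Embeds.trans {H G K : HGraph r} (h₁ : H.Embeds G) (h₂ : G.Embeds K) : H.Embeds K := by
  obtain ⟨f, hf, hfe⟩ := h₁
  obtain ⟨g, hg, hge⟩ := h₂
  refine ⟨g ∘ f, hg.comp hf, fun e he => ?_⟩
  rw [← Finset.image_image]
  exact hge _ (hfe e he)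

theorem edges_subset_powersetCard (G : HGraph r) :
    G.edges ⊆ Finset.powersetCard r Finset.univ := fun e he => by
  simp [Finset.mem_powersetCard, G.card_eq e he]

theorem card_edges_le (G : HGraph r) : G.edges.card ≤ G.n.choose r := by
  simpa using Finset.card_le_card G.edges_subset_powersetCard

/-- The `r`-graph on `n` vertices without edges. -/
def empty (r n : ℕ) : HGraph r := ⟨n, ∅, by simp⟩

/-- The subgraph of `G` induced on `V`, relabelled by `Fin V.card`. -/
def induce (G : HGraph r) (V : Finset (Fin G.n)) : HGraph r where
  n := V.card
  edges := Finset.univ.filter fun e => e.image (V.orderEmbOfFin rfl) ∈ G.edges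
  card_eq e he := by
    rw [← Finset.card_image_of_injective e (V.orderEmbOfFin rfl).injective]
    exact G.card_eq _ (Finset.mem_filter.1 he).2

theorem mem_edges_induce (G : HGraph r) (V : Finset (Fin G.n)) (e : Finset (Fin V.card)) :
    e ∈ (G.induce V).edges ↔ e.image (V.orderEmbOfFin rfl) ∈ G.edges :=
  Finset.mem_filter.trans (and_iff_right (Finset.mem_univ e))

theorem card_edges_induce (G : HGraph r) (V : Finset (Fin G.n)) :
    (G.induce V).edges.card = (G.edges.filter (· ⊆ V)).card := by
  have hinj := (V.orderEmbOfFin rfl).injective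
  refine (Finset.card_image_of_injective (G.induce V).edges
    (Finset.image_injective hinj)).symm.trans (congrArg Finset.card ?_)
  ext e
  simp only [induce, Finset.mem_image, Finset.mem_filter, Finset.mem_univ, true_and]
  constructor
  · rintro ⟨a, ha, rfl⟩
    refine ⟨ha, fun v hv => ?_⟩
    obtain ⟨w, -, rfl⟩ := Finset.mem_image.1 hv
    exact V.orderEmbOfFin_mem rfl w
  · rintro ⟨he, heV⟩
    have h : e ⊆ Finset.univ.image (V.orderEmbOfFin rfl) := fun v hv => by
      have : v ∈ Set.range (V.orderEmbOfFin rfl) := by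
        rw [V.range_orderEmbOfFin rfl]
        exact heV hv
      simpa using this
    obtain ⟨a, -, rfl⟩ := Finset.subset_image_iff.1 h
    exact ⟨a, he, rfl⟩

end HGraph

section ExNum

variable {r : ℕ} (F : Set (HGraph r))

theorem bddAbove_card_edges (n : ℕ) :
    BddAbove {m : ℕ | ∃ G : HGraph r, G.n = n ∧ IsFree F G ∧ G.edges.card = m} := by
  refine ⟨n.choose r, ?_⟩
  rintro m ⟨G, rfl, -, rfl⟩
  exact G.card_edges_le

variable {F}

theorem IsFree.of_embeds {H G : HGraph r} (h : H.Embeds G) (hG : IsFree F G) : IsFree F H :=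
  fun K hK hKH => hG K hK (hKH.trans h)

theorem IsFree.card_edges_le_exNum {G : HGraph r} (hG : IsFree F G) :
    G.edges.card ≤ exNum r F G.n :=
  le_csSup (bddAbove_card_edges F G.n) ⟨G, rfl, hG, rfl⟩

variable (F) in
theorem exNum_attained_or_eq_zero (n : ℕ) :
    (∃ G : HGraph r, G.n = n ∧ IsFree F G ∧ G.edges.card = exNum r F n) ∨ exNum r F n = 0 := by
  rcases Set.eq_empty_or_nonempty
    {m : ℕ | ∃ G : HGraph r, G.n = n ∧ IsFree F G ∧ G.edges.card = m} with h | h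
  · right
    rw [exNum, h]
    simp
  · exact Or.inl (Nat.sSup_mem h (bddAbove_card_edges F n))

variable (F) in
theorem exNum_le_choose (n : ℕ) : exNum r F n ≤ n.choose r := by
  rcases exNum_attained_or_eq_zero F n with ⟨G, rfl, -, h⟩ | h
  · exact h ▸ G.card_edges_le
  · omega

variable (F) in
/-- `G` is `F`-free or has no edges. -/
def IsFreeOrEdgeless (G : HGraph r) : Prop := G.edges = ∅ ∨ IsFree F G

theorem IsFreeOrEdgeless.of_embeds {H G : HGraph r} (h : H.Embeds G)
    (hG : IsFreeOrEdgeless F G) : IsFreeOrEdgeless F H := by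
  rcases hG with hG | hG
  · obtain ⟨f, -, hf⟩ := h
    exact Or.inl (Finset.eq_empty_of_forall_notMem fun e he => by simpa [hG] using hf e he)
  · exact Or.inr (hG.of_embeds h)

theorem IsFreeOrEdgeless.card_edges_le_exNum {G : HGraph r} (hG : IsFreeOrEdgeless F G) :
    G.edges.card ≤ exNum r F G.n := by
  rcases hG with hG | hG
  · simp [hG]
  · exact hG.card_edges_le_exNum

variable (F) in
theorem exists_isFreeOrEdgeless_card_edges_eq (n : ℕ) :
    ∃ G : HGraph r, G.n = n ∧ IsFreeOrEdgeless F G ∧ G.edges.card = exNum r F n := by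
  rcases exNum_attained_or_eq_zero F n with ⟨G, hn, hG, h⟩ | h
  · exact ⟨G, hn, Or.inr hG, h⟩
  · exact ⟨HGraph.empty r n, rfl, Or.inl rfl, by simp [h, HGraph.empty]⟩

end ExNum

section Join

variable {r : ℕ} (F : Set (HGraph r)) (M : ℕ)

/-- `G` is a subgraph of a complete join of `M` graphs that are `F`-free or edgeless: its vertices
can be coloured with `M` colours so that all monochromatic subgraphs are `F`-free or edgeless. -/
def IsSubJoin (G : HGraph r) : Prop :=
  ∃ c : Fin G.n → Fin M, ∀ (i : Fin M) (H : HGraph r) (f : Fin H.n → Fin G.n),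
    Function.Injective f → (∀ v, c (f v) = i) → (∀ e ∈ H.edges, e.image f ∈ G.edges) →
      IsFreeOrEdgeless F H

/-- The family of all `r`-graphs which are not subgraphs of a complete join. -/
def joinFamily : Set (HGraph r) := {G | ¬ IsSubJoin F M G}

variable {F M}

theorem IsSubJoin.of_embeds {H G : HGraph r} (h : H.Embeds G) (hG : IsSubJoin F M G) :
    IsSubJoin F M H := by
  obtain ⟨g, hg, hge⟩ := h
  obtain ⟨c, hc⟩ := hG
  refine ⟨c ∘ g, fun i K f hf hcf hfe => hc i K (g ∘ f) (hg.comp hf) hcf fun e he => ?_⟩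
  rw [← Finset.image_image]
  exact hge _ (hfe e he)

theorem isFree_joinFamily_iff {G : HGraph r} : IsFree (joinFamily F M) G ↔ IsSubJoin F M G := by
  constructor
  · intro h
    by_contra hG
    exact h G hG (HGraph.Embeds.refl G)
  · exact fun hG H hH hHG => hH (hG.of_embeds hHG)

theorem IsSubJoin.exists_card_edges_add_le (hr : r ≠ 0) {G : HGraph r} (hG : IsSubJoin F M G) :
    ∃ s : Fin M → ℕ, ∑ i, s i = G.n ∧
      G.edges.card + ∑ i, (s i).choose r ≤ G.n.choose r + ∑ i, exNum r F (s i) := by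
  obtain ⟨c, hc⟩ := hG
  let V : Fin M → Finset (Fin G.n) := fun i => Finset.univ.filter fun v => c v = i
  have hV : ∀ i v, v ∈ V i ↔ c v = i := by simp [V]
  refine ⟨fun i => (V i).card, ?_, ?_⟩
  · have h := Finset.card_eq_sum_card_fiberwise (f := c) (s := Finset.univ) (t := Finset.univ)
      (by simp)
    simpa [V] using h.symm
  have hmono : ∀ i, (G.edges.filter (· ⊆ V i)).card ≤ exNum r F (V i).card := fun i => by
    rw [← G.card_edges_induce]
    refine IsFreeOrEdgeless.card_edges_le_exNum (G := G.induce (V i))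
      (hc i _ ((V i).orderEmbOfFin rfl) ((V i).orderEmbOfFin rfl).injective ?_ ?_)
    · exact fun v => (hV i _).1 ((V i).orderEmbOfFin_mem rfl v)
    · exact fun e => (G.mem_edges_induce (V i) e).1
  let B : Fin M → Finset (Finset (Fin G.n)) := fun i => Finset.powersetCard r (V i) \ G.edges
  have hB : ∀ i, (V i).card.choose r = (B i).card + (G.edges.filter (· ⊆ V i)).card := fun i => by
    rw [← Finset.card_powersetCard, ← Finset.card_sdiff_add_card_inter _ G.edges]
    congr 2
    ext e
    simp only [Finset.mem_inter, Finset.mem_powersetCard, Finset.mem_filter]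
    exact ⟨fun h => ⟨h.2, h.1.1⟩, fun h => ⟨⟨h.2, G.card_eq e h.1⟩, h.1⟩⟩
  have hdisj : ∀ i ∈ (Finset.univ : Finset (Fin M)), ∀ j ∈ (Finset.univ : Finset (Fin M)),
      i ≠ j → Disjoint (B i) (B j) := by
    intro i _ j _ hij
    rw [Finset.disjoint_left]
    intro e hi hj
    simp only [B, Finset.mem_sdiff, Finset.mem_powersetCard] at hi hj
    obtain ⟨v, hv⟩ : e.Nonempty := by
      rw [← Finset.card_pos]
      omega
    exact hij (((hV i v).1 (hi.1.1 hv)).symm.trans ((hV j v).1 (hj.1.1 hv)))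
  have hunion : G.edges.card + ∑ i, (B i).card ≤ G.n.choose r := by
    rw [← Finset.card_biUnion hdisj, ← Finset.card_union_of_disjoint]
    · have h : G.edges ∪ Finset.univ.biUnion B ⊆ Finset.powersetCard r Finset.univ := by
        refine Finset.union_subset G.edges_subset_powersetCard ?_
        refine Finset.biUnion_subset.2 fun i _ => ?_
        exact Finset.sdiff_subset.trans (Finset.powersetCard_mono (Finset.subset_univ _))
      simpa using Finset.card_le_card h
    · rw [Finset.disjoint_biUnion_right]
      exact fun i _ => Finset.disjoint_sdiff
  have hsum := Finset.sum_le_sum fun i (_ : i ∈ Finset.univ) => hmono i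
  simp only [hB, Finset.sum_add_distrib]
  omega

variable (F) in
theorem exists_isSubJoin_of_coloring {n : ℕ} (c : Fin n → Fin M) :
    ∃ G : HGraph r, G.n = n ∧ IsSubJoin F M G ∧
      n.choose r + ∑ i, exNum r F (Finset.univ.filter fun v => c v = i).card ≤
        G.edges.card + ∑ i, (Finset.univ.filter fun v => c v = i).card.choose r := by
  let V : Fin M → Finset (Fin n) := fun i => Finset.univ.filter fun v => c v = i
  have hV : ∀ i v, v ∈ V i ↔ c v = i := by simp [V]
  choose K hKn hK hKcard using fun i => exists_isFreeOrEdgeless_card_edges_eq F (V i).card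
  let φ : ∀ i, Fin (K i).n → Fin n := fun i => (V i).orderEmbOfFin (hKn i).symm
  have hφ : ∀ i, Function.Injective (φ i) := fun i =>
    ((V i).orderEmbOfFin (hKn i).symm).injective
  have hφV : ∀ i v, v ∈ V i → ∃ w, φ i w = v := fun i v hv => by
    have : v ∈ Set.range ((V i).orderEmbOfFin (hKn i).symm) := by
      rw [Finset.range_orderEmbOfFin]
      exact hv
    exact this
  let E : ∀ i, Finset (Finset (Fin n)) := fun i => (K i).edges.image (Finset.image (φ i))
  let G : HGraph r :=
    { n := n
      edges := (Finset.powersetCard r Finset.univ).filter fun e => ∀ i, e ⊆ V i → e ∈ E i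
      card_eq := fun e he => (Finset.mem_powersetCard.1 (Finset.mem_filter.1 he).1).2 }
  refine ⟨G, rfl, ⟨c, fun i H f hf hcf hfe => ?_⟩, ?_⟩
  · choose g hg using fun v => hφV i (f v) ((hV i _).2 (hcf v))
    have hgf : φ i ∘ g = f := funext hg
    refine (hK i).of_embeds ⟨g, Function.Injective.of_comp (f := φ i) (hgf ▸ hf), fun e he => ?_⟩
    have hsub : e.image f ⊆ V i := fun v hv => by
      obtain ⟨w, -, rfl⟩ := Finset.mem_image.1 hv
      exact (hV i _).2 (hcf w)
    have hE : e.image f ∈ E i := (Finset.mem_filter.1 (hfe e he)).2 i hsub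
    rw [← hgf, ← Finset.image_image] at hE
    obtain ⟨a, ha, hae⟩ := Finset.mem_image.1 hE
    exact Finset.image_injective (hφ i) hae ▸ ha
  have hEcard : ∀ i, (E i).card = exNum r F (V i).card := fun i => by
    rw [Finset.card_image_of_injective _ (Finset.image_injective (hφ i)), hKcard]
  have hEsub : ∀ i, E i ⊆ Finset.powersetCard r (V i) := fun i e he => by
    obtain ⟨a, ha, rfl⟩ := Finset.mem_image.1 he
    rw [Finset.mem_powersetCard, Finset.card_image_of_injective _ (hφ i)]
    refine ⟨fun v hv => ?_, (K i).card_eq a ha⟩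
    obtain ⟨w, -, rfl⟩ := Finset.mem_image.1 hv
    exact (V i).orderEmbOfFin_mem (hKn i).symm w
  have hmiss : ∀ i, (V i).card.choose r =
      (Finset.powersetCard r (V i) \ E i).card + exNum r F (V i).card := fun i => by
    rw [← hEcard, Finset.card_sdiff_add_card_eq_card (hEsub i), Finset.card_powersetCard]
  have hcover : Finset.powersetCard r (Finset.univ : Finset (Fin n)) ⊆
      G.edges ∪ Finset.univ.biUnion fun i => Finset.powersetCard r (V i) \ E i := fun e he => by
    by_cases h : ∀ i, e ⊆ V i → e ∈ E i
    · exact Finset.mem_union_left _ (Finset.mem_filter.2 ⟨he, h⟩)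
    · push Not at h
      obtain ⟨i, hi, hiE⟩ := h
      refine Finset.mem_union_right _ (Finset.mem_biUnion.2 ⟨i, Finset.mem_univ i, ?_⟩)
      exact Finset.mem_sdiff.2
        ⟨Finset.mem_powersetCard.2 ⟨hi, (Finset.mem_powersetCard.1 he).2⟩, hiE⟩
  have h₁ := (Finset.card_le_card hcover).trans (Finset.card_union_le _ _)
  have h₂ := Finset.card_biUnion_le (s := Finset.univ)
    (t := fun i => Finset.powersetCard r (V i) \ E i)
  have h₃ : ∑ i, (V i).card.choose r =
      ∑ i, (Finset.powersetCard r (V i) \ E i).card + ∑ i, exNum r F (V i).card := by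
    rw [← Finset.sum_add_distrib]
    exact Finset.sum_congr rfl fun i _ => hmiss i
  rw [Finset.card_powersetCard, Finset.card_univ, Fintype.card_fin] at h₁
  change n.choose r + ∑ i, exNum r F (V i).card ≤ G.edges.card + ∑ i, (V i).card.choose r
  omega

theorem exists_coloring_card_le (hM : 0 < M) (n : ℕ) :
    ∃ c : Fin n → Fin M, ∀ i, (Finset.univ.filter fun v => c v = i).card ≤ n / M + 1 := by
  refine ⟨fun v => ⟨v % M, Nat.mod_lt _ hM⟩, fun i => ?_⟩
  rw [← Finset.card_range (n / M + 1)]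
  refine Finset.card_le_card_of_injOn (fun v => (v : ℕ) / M) (fun v _ => ?_) fun v hv w hw h => ?_
  · simpa [Nat.lt_succ_iff] using Nat.div_le_div_right v.2.le
  · simp only [Finset.coe_filter, Finset.mem_univ, true_and, Set.mem_ofPred_eq] at hv hw
    have hvw : (v : ℕ) % M = w % M := congrArg Fin.val (hv.trans hw.symm)
    ext
    rw [← Nat.div_add_mod (v : ℕ) M, ← Nat.div_add_mod (w : ℕ) M, hvw]
    simp only at h
    rw [h]

variable (F) in
/-- The least number of `r`-sets missing from an extremal `r`-graph on `n` vertices. -/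
noncomputable def coExNum (n : ℕ) : ℝ := (n.choose r : ℝ) - exNum r F n

theorem exists_sum_coExNum_le (hr : r ≠ 0) (hM : 0 < M) (n : ℕ) :
    ∃ s : Fin M → ℕ, ∑ i, s i = n ∧ ∑ i, coExNum F (s i) ≤ coExNum (joinFamily F M) n := by
  obtain ⟨c, -⟩ := exists_coloring_card_le hM n
  obtain ⟨G, hn, hG, h⟩ : ∃ G : HGraph r, G.n = n ∧ IsSubJoin F M G ∧
      G.edges.card = exNum r (joinFamily F M) n := by
    rcases exNum_attained_or_eq_zero (joinFamily F M) n with ⟨G, hn, hG, h⟩ | h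
    · exact ⟨G, hn, isFree_joinFamily_iff.1 hG, h⟩
    · refine ⟨HGraph.empty r n, rfl, ⟨c, fun i H f _ _ hfe => Or.inl ?_⟩, by simp [h, HGraph.empty]⟩
      exact Finset.eq_empty_of_forall_notMem fun e he =>
        Finset.notMem_empty _ (hfe e he)
  obtain ⟨s, hs, hsum⟩ := hG.exists_card_edges_add_le hr
  rw [h, congrArg (Nat.choose · r) hn] at hsum
  refine ⟨s, hs.trans hn, ?_⟩
  have hsum' : (exNum r (joinFamily F M) n : ℝ) + ∑ i, ((s i).choose r : ℝ) ≤
      (n.choose r : ℝ) + ∑ i, (exNum r F (s i) : ℝ) := by exact_mod_cast hsum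
  simp only [coExNum, Finset.sum_sub_distrib]
  linarith

theorem exists_coExNum_le_sum (hM : 0 < M) (n : ℕ) :
    ∃ s : Fin M → ℕ, (∀ i, s i ≤ n / M + 1) ∧
      coExNum (joinFamily F M) n ≤ ∑ i, coExNum F (s i) := by
  obtain ⟨c, hc⟩ := exists_coloring_card_le hM n
  obtain ⟨G, hn, hG, h⟩ := exists_isSubJoin_of_coloring F c
  refine ⟨_, hc, ?_⟩
  have hle := (isFree_joinFamily_iff.2 hG).card_edges_le_exNum.trans_eq
    (congrArg (exNum r (joinFamily F M)) hn)
  replace h := h.trans (Nat.add_le_add_right hle _)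
  have h' : (n.choose r : ℝ) + ∑ i, (exNum r F (Finset.univ.filter fun v => c v = i).card : ℝ) ≤
      exNum r (joinFamily F M) n +
        ∑ i, ((Finset.univ.filter fun v => c v = i).card.choose r : ℝ) := by exact_mod_cast h
  simp only [coExNum, Finset.sum_sub_distrib]
  linarith

end Join

section Asymptotics

/-- A sequence asymptotic to `y * n ^ r` is, up to a constant, within `ε * n ^ r` of it. -/
theorem exists_abs_sub_le_of_tendsto_div_pow {h : ℕ → ℝ} {r : ℕ} {y : ℝ}
    (hh : Tendsto (fun n => h n / (n : ℝ) ^ r) atTop (nhds y)) {ε : ℝ} (hε : 0 < ε) :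
    ∃ C : ℝ, ∀ n : ℕ, |h n - y * (n : ℝ) ^ r| ≤ ε * (n : ℝ) ^ r + C := by
  obtain ⟨N, hN⟩ := Metric.tendsto_atTop.1 hh ε hε
  refine ⟨∑ n ∈ Finset.range (N + 1), |h n - y * (n : ℝ) ^ r|, fun n => ?_⟩
  rcases le_or_gt n N with hn | hn
  · have := Finset.single_le_sum (f := fun n : ℕ => |h n - y * (n : ℝ) ^ r|)
      (fun _ _ => abs_nonneg _) (Finset.mem_range.2 (Nat.lt_succ_of_le hn))
    have : 0 ≤ ε * (n : ℝ) ^ r := by positivity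
    linarith
  · have hpos : (0 : ℝ) < (n : ℝ) ^ r := by
      have : (0 : ℝ) < n := by exact_mod_cast (Nat.zero_le N).trans_lt hn
      positivity
    have h₁ := (hN n hn.le).le
    have h₂ : h n / (n : ℝ) ^ r - y = (h n - y * (n : ℝ) ^ r) / (n : ℝ) ^ r := by field_simp
    rw [Real.dist_eq, h₂, abs_div, abs_of_pos hpos, div_le_iff₀ hpos] at h₁
    have : 0 ≤ ∑ n ∈ Finset.range (N + 1), |h n - y * (n : ℝ) ^ r| :=
      Finset.sum_nonneg fun _ _ => abs_nonneg _
    linarith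

theorem tendsto_div_pow_of_sum_le_of_le_sum {h h' : ℕ → ℝ} {k M : ℕ} {y : ℝ} (hM : 0 < M)
    (hy : 0 ≤ y) (hh : Tendsto (fun n => h n / (n : ℝ) ^ (k + 1)) atTop (nhds y))
    (hlow : ∀ n, ∃ s : Fin M → ℕ, ∑ i, s i = n ∧ ∑ i, h (s i) ≤ h' n)
    (hupp : ∀ n, ∃ s : Fin M → ℕ, (∀ i, s i ≤ n / M + 1) ∧ h' n ≤ ∑ i, h (s i)) :
    Tendsto (fun n => h' n / (n : ℝ) ^ (k + 1)) atTop (nhds (y / (M : ℝ) ^ k)) := by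
  have hM' : (0 : ℝ) < M := by exact_mod_cast hM
  have hinv : Tendsto (fun n : ℕ => (n : ℝ)⁻¹) atTop (nhds 0) := tendsto_inv_atTop_nhds_zero_nat
  have hinvp : Tendsto (fun n : ℕ => ((n : ℝ) ^ (k + 1))⁻¹) atTop (nhds 0) := by
    simpa [inv_pow] using hinv.pow (k + 1)
  rw [tendsto_order]
  constructor
  · intro a ha
    obtain ⟨ε, hε, haε⟩ : ∃ ε : ℝ, 0 < ε ∧ a < y / (M : ℝ) ^ k - M * ε :=
      ⟨(y / (M : ℝ) ^ k - a) / (2 * M), div_pos (sub_pos.2 ha) (by positivity), by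
        field_simp
        have := sub_pos.2 ha
        field_simp at this
        linarith⟩
    obtain ⟨C, hC⟩ := exists_abs_sub_le_of_tendsto_div_pow hh hε
    have hlim : Tendsto (fun n : ℕ => y / (M : ℝ) ^ k - M * ε - M * C * ((n : ℝ) ^ (k + 1))⁻¹)
        atTop (nhds (y / (M : ℝ) ^ k - M * ε)) := by
      simpa using tendsto_const_nhds.sub (hinvp.const_mul (M * C))
    filter_upwards [hlim.eventually (lt_mem_nhds haε), eventually_gt_atTop 0] with n hn hn0
    refine hn.trans_le ?_
    have hnpos : (0 : ℝ) < (n : ℝ) ^ (k + 1) := by positivity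
    rw [le_div_iff₀ hnpos]
    obtain ⟨s, hs, hsum⟩ := hlow n
    have hpow : (n : ℝ) ^ (k + 1) / (M : ℝ) ^ k ≤ ∑ i, (s i : ℝ) ^ (k + 1) := by
      have h₀ := pow_sum_div_card_le_sum_pow (s := Finset.univ) (f := fun i => (s i : ℝ))
        (fun i _ => Nat.cast_nonneg _) k
      rw [← hs]
      simpa using h₀
    have hterm : ∀ i, y * (s i : ℝ) ^ (k + 1) - ε * (n : ℝ) ^ (k + 1) - C ≤ h (s i) := fun i => by
      have h₁ := (abs_le.1 (hC (s i))).1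
      have h₂ : s i ≤ n := hs ▸ Finset.single_le_sum (fun _ _ => Nat.zero_le _) (Finset.mem_univ i)
      have h₃ : ε * (s i : ℝ) ^ (k + 1) ≤ ε * (n : ℝ) ^ (k + 1) := by gcongr
      linarith
    have htot := (Finset.sum_le_sum fun i (_ : i ∈ Finset.univ) => hterm i).trans hsum
    simp only [Finset.sum_sub_distrib, ← Finset.mul_sum, Finset.sum_const, Finset.card_univ,
      Fintype.card_fin, nsmul_eq_mul] at htot
    have hy' := mul_le_mul_of_nonneg_left hpow hy
    calc _ = y * ((n : ℝ) ^ (k + 1) / (M : ℝ) ^ k) - M * (ε * (n : ℝ) ^ (k + 1)) - M * C := by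
          field_simp
      _ ≤ h' n := by linarith
  · intro a ha
    replace ha := gt_iff_lt.1 ha
    obtain ⟨ε, hε, haε⟩ : ∃ ε : ℝ, 0 < ε ∧ (y + ε) / (M : ℝ) ^ k < a :=
      ⟨(a * (M : ℝ) ^ k - y) / 2, by
        rw [div_lt_iff₀ (by positivity)] at ha
        linarith, by
        rw [div_lt_iff₀ (by positivity)] at ha ⊢
        linarith⟩
    obtain ⟨C, hC⟩ := exists_abs_sub_le_of_tendsto_div_pow hh hε
    have hlim : Tendsto (fun n : ℕ => M * (y + ε) * ((M : ℝ)⁻¹ + (n : ℝ)⁻¹) ^ (k + 1) +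
        M * C * ((n : ℝ) ^ (k + 1))⁻¹) atTop (nhds ((y + ε) / (M : ℝ) ^ k)) := by
      have h₁ := ((tendsto_const_nhds (x := (M : ℝ)⁻¹)).add hinv).pow (k + 1)
      convert (h₁.const_mul (M * (y + ε))).add (hinvp.const_mul (M * C)) using 2
      rw [mul_zero, add_zero, add_zero, inv_pow, pow_succ]
      field_simp
    filter_upwards [hlim.eventually (gt_mem_nhds haε), eventually_gt_atTop 0] with n hn hn0
    refine lt_of_le_of_lt ?_ hn
    have hn1 : (0 : ℝ) < n := by exact_mod_cast hn0
    rw [div_le_iff₀ (by positivity)]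
    obtain ⟨s, hs, hsum⟩ := hupp n
    have hterm : ∀ i, h (s i) ≤ (y + ε) * ((n : ℝ) / M + 1) ^ (k + 1) + C := fun i => by
      have h₁ := (abs_le.1 (hC (s i))).2
      have h₂ : (s i : ℝ) ≤ (n : ℝ) / M + 1 := by
        have : (s i : ℝ) ≤ ((n / M : ℕ) : ℝ) + 1 := by exact_mod_cast hs i
        linarith [Nat.cast_div_le (α := ℝ) (m := n) (n := M)]
      have h₃ : (y + ε) * (s i : ℝ) ^ (k + 1) ≤ (y + ε) * ((n : ℝ) / M + 1) ^ (k + 1) := by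
        gcongr
      linarith
    have htot := hsum.trans (Finset.sum_le_sum fun i (_ : i ∈ Finset.univ) => hterm i)
    simp only [Finset.sum_const, Finset.card_univ, Fintype.card_fin, nsmul_eq_mul] at htot
    have h₄ : (n : ℝ) / M + 1 = ((M : ℝ)⁻¹ + (n : ℝ)⁻¹) * n := by field_simp
    refine htot.trans_eq ?_
    rw [h₄, mul_pow]
    field_simp

theorem tendsto_choose_div_pow (r : ℕ) :
    Tendsto (fun n : ℕ => (n.choose r : ℝ) / (n : ℝ) ^ r) atTop (nhds (r.factorial : ℝ)⁻¹) := by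
  have h : Tendsto (fun n : ℕ => (n : ℝ) ^ r / r.factorial / (n : ℝ) ^ r) atTop
      (nhds (r.factorial : ℝ)⁻¹) := by
    refine tendsto_const_nhds.congr' ?_
    filter_upwards [eventually_gt_atTop 0] with n hn
    have : (n : ℝ) ≠ 0 := by exact_mod_cast hn.ne'
    field_simp
  exact ((isEquivalent_choose r).div Asymptotics.IsEquivalent.refl).tendsto_nhds_iff.2 h

theorem hasTuranDensity_iff_tendsto_coExNum {r : ℕ} {F : Set (HGraph r)} {x : ℝ} :
    HasTuranDensity r F x ↔
      Tendsto (fun n => coExNum F n / (n : ℝ) ^ r) atTop (nhds ((1 - x) / r.factorial)) := by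
  have hc := tendsto_choose_div_pow r
  have hf : (r.factorial : ℝ) ≠ 0 := by exact_mod_cast r.factorial_ne_zero
  constructor
  · intro h
    refine ((h.const_sub 1).mul hc).congr' ?_
    filter_upwards [eventually_ge_atTop r] with n hn
    have : (n.choose r : ℝ) ≠ 0 := by exact_mod_cast (Nat.choose_pos hn).ne'
    rw [coExNum]
    field_simp
  · intro h
    have h' := (h.div hc (inv_ne_zero hf)).const_sub 1
    have he : 1 - (1 - x) / r.factorial / (r.factorial : ℝ)⁻¹ = x := by
      field_simp
      ring
    rw [he] at h'
    refine h'.congr' ?_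
    filter_upwards [eventually_ge_atTop r, eventually_gt_atTop 0] with n hn hn0
    have : (n.choose r : ℝ) ≠ 0 := by exact_mod_cast (Nat.choose_pos hn).ne'
    have : (n : ℝ) ≠ 0 := by exact_mod_cast hn0.ne'
    simp only [Pi.div_apply, coExNum]
    field_simp
    ring

theorem coExNum_nonneg {r : ℕ} (F : Set (HGraph r)) (n : ℕ) : 0 ≤ coExNum F n :=
  sub_nonneg.2 (by exact_mod_cast exNum_le_choose F n)

end Asymptotics

/-- Complete join: if `x ∈ Π^{(r)}_∞` and `M ≥ 2`, then
`1 - (1-x)/M^{r-1} ∈ Π^{(r)}_∞`. -/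
theorem complete_join_density (r M : ℕ) (hr : 3 ≤ r) (hM : 2 ≤ M) (x : ℝ)
    (hx : x ∈ PiInf r) :
    1 - (1 - x) / (M : ℝ) ^ (r - 1) ∈ PiInf r := by
  obtain ⟨F, hF⟩ := hx
  refine ⟨joinFamily F M, ?_⟩
  rw [hasTuranDensity_iff_tendsto_coExNum] at hF ⊢
  obtain ⟨k, rfl⟩ : ∃ k, r = k + 1 := ⟨r - 1, by omega⟩
  have hM' : 0 < M := by omega
  have hy := ge_of_tendsto' hF fun n => div_nonneg (coExNum_nonneg F n) (by positivity)
  convert tendsto_div_pow_of_sum_le_of_le_sum hM' hy hF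
    (exists_sum_coExNum_le (Nat.succ_ne_zero k) hM') (exists_coExNum_le_sum hM') using 2
  rw [sub_sub_cancel, div_right_comm, Nat.add_sub_cancel]
end
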